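/- Let U be a group acting on ℤ by bijections, each of which is an (L,A)-quasi-isometry of ℤ with its standard metric. Then there exist an isometric action of U on ℤ and a surjective U-equivariant map f : ℤ → ℤ (from the first action to the second) which is an (L',A')-quasi-isometry, where L' and A' depend only on L and A. -/

import Mathlib

/-- `f : ℤ → ℤ` is an `(L,A)`-quasi-isometry of `ℤ` with its standard metric:
`L⁻¹·|m−n| − A ≤ |f m − f n| ≤ L·|m−n| + A` for all `m n`, and the image of `f`
is `A`-dense in `ℤ`. -/
def IsQIZ (L A : ℝ) (f : ℤ → ℤ) : Prop :=
  (∀ m n : ℤ,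
      L⁻¹ * |(m : ℝ) - n| - A ≤ |(f m : ℝ) - f n| ∧
      |(f m : ℝ) - f n| ≤ L * |(m : ℝ) - n| + A) ∧
  ∀ n : ℤ, ∃ m : ℤ, |(n : ℝ) - f m| ≤ A


lemma aux_pos (u : ℤ → ℤ) (M : ℤ)
    (h1 : ∀ m n, |u m - u n| ≤ M * |m - n| + M)
    (h2 : ∀ m n, |m - n| ≤ M * |u m - u n| + M * M) (hM : 1 ≤ M) (R : ℤ)
    (hR : R = 3 * M * M + 1) :
    ∀ x y, R ≤ y - x → 0 < (if u 0 < u R then (1 : ℤ) else -1) * (u y - u x) := by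
  have big : ∀ x y, R ≤ y - x → 2 * M < |u y - u x| := by
    intro x y h
    by_contra hc
    push Not at hc
    have := h2 y x
    have h3 : y - x ≤ |y - x| := le_abs_self _
    nlinarith
  have stp : ∀ x, |u (x + 1) - u x| ≤ 2 * M := by
    intro x
    have := h1 (x + 1) x
    simp at this
    linarith
  have sy : ∀ x y, R ≤ y - x → (u x < u (y + 1) ↔ u x < u y) := by
    intro x y h
    have a := big x y h
    have b := big x (y + 1) (by linarith)
    have c := stp y
    grind
  have sx : ∀ x y, R ≤ y - (x + 1) → (u (x + 1) < u y ↔ u x < u y) := by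
    intro x y h
    have a := big x y (by linarith)
    have b := big (x + 1) y (by linarith)
    have c := stp x
    grind
  have c1 : ∀ x, (u x < u (x + R) ↔ u 0 < u R) := by
    have st : ∀ x, (u (x + 1) < u (x + 1 + R) ↔ u x < u (x + R)) := by
      intro x
      rw [sx x (x + 1 + R) (by linarith), show x + 1 + R = x + R + 1 by ring,
        sy x (x + R) (by linarith)]
    intro x
    induction x using Int.induction_on with
    | zero => simp
    | succ i ih => rw [st, ih]
    | pred i ih =>
      rw [← st]
      simpa using ih
  have c2 : ∀ x (k : ℕ), (u x < u (x + R + k) ↔ u 0 < u R) := by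
    intro x k
    induction k with
    | zero => simpa using c1 x
    | succ k ih =>
      rw [← ih, show x + R + ((k + 1 : ℕ) : ℤ) = x + R + k + 1 by push_cast; ring]
      exact sy x _ (by linarith [Int.natCast_nonneg k])
  intro x y h
  have := c2 x (y - x - R).toNat
  have e : x + R + ((y - x - R).toNat : ℤ) = y := by omega
  rw [e] at this
  have hb := big x y h
  have : u x ≠ u y := by
    intro hh
    rw [hh] at hb
    simp at hb
    linarith
  split_ifs <;> omega

def ss (x n : ℤ) : ℤ := if x ≤ n then 1 else -1

lemma ss_fin (a b : ℤ) : (Function.support fun n => ss a n - ss b n).Finite := by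
  apply (Set.finite_Icc (min a b) (max a b)).subset
  intro n hn
  simp only [Function.mem_support, ss] at hn
  simp only [Set.mem_Icc]
  split_ifs at hn <;> first | omega | simp at hn

lemma ss_sum_le (a b : ℤ) (h : a ≤ b) : ∑ᶠ n, (ss a n - ss b n) = 2 * (b - a) := by
  rw [finsum_eq_sum_of_support_subset (s := Finset.Ico a b)]
  · rw [Finset.sum_congr rfl (g := fun _ => (2 : ℤ))]
    · simp [h]; ring
    · intro n hn
      simp at hn
      simp [ss, hn.1, not_le.2 hn.2]
  · intro n hn
    simp only [Function.mem_support, ss] at hn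
    simp only [Finset.coe_Ico, Set.mem_Ico]
    split_ifs at hn <;> first | omega | simp at hn

lemma ss_sum (a b : ℤ) : ∑ᶠ n, (ss a n - ss b n) = 2 * (b - a) := by
  rcases le_total a b with h | h
  · exact ss_sum_le a b h
  · have := ss_sum_le b a h
    have e : (fun n => ss a n - ss b n) = fun n => -(ss b n - ss a n) := by
      ext; ring
    rw [e, finsum_neg_distrib, this]; ring

lemma strict_exp (g : ℤ → ℤ) (h : StrictMono g) (m n : ℤ) (hmn : m ≤ n) :
    n - m ≤ g n - g m := by
  induction n, hmn using Int.leInduction with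
  | base => simp
  | succ n _ ih =>
    have : g n < g (n + 1) := h (by simp)
    linarith

lemma strict_exp_abs (g : ℤ → ℤ) (h : StrictMono g) (m n : ℤ) :
    |m - n| ≤ |g m - g n| := by
  rcases le_total m n with h1 | h1
  · have := strict_exp g h m n h1
    rw [abs_sub_comm, abs_of_nonneg (by linarith)]
    rw [abs_sub_comm]
    exact this.trans (le_abs_self _)
  · have := strict_exp g h n m h1
    rw [abs_of_nonneg (by linarith)]
    exact this.trans (le_abs_self _)

lemma flux {U : Type} [Group U] (ρ : U →* Equiv.Perm ℤ) (M : ℤ) (hM : 1 ≤ M)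
    (h1 : ∀ u m n, |ρ u m - ρ u n| ≤ M * |m - n| + M)
    (h2 : ∀ u m n, |m - n| ≤ M * |ρ u m - ρ u n| + M * M)
    (C' : ℤ) (hC' : C' = M * (3 * M * M + 1) + M) :
    ∃ (ε T : U → ℤ), (∀ u, ε u = 1 ∨ ε u = -1) ∧ (∀ u v, ε (u * v) = ε u * ε v) ∧
      (∀ u v, T (u * v) = T u + ε u * T v) ∧
      ∀ u x, |ε u * (2 * x) + T u - 2 * ρ u x| ≤ 2 * (2 * C' + 1) := by
  obtain ⟨R, hR⟩ : ∃ R, R = 3 * M * M + 1 := ⟨_, rfl⟩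
  have hRp : 0 < R := by nlinarith
  set ε : U → ℤ := fun u => if ρ u 0 < ρ u R then (1 : ℤ) else -1 with hε
  have e1 : ∀ u, ε u = 1 ∨ ε u = -1 := by
    intro u; simp only [hε]; split_ifs <;> simp
  have pos : ∀ u x y, R ≤ y - x → 0 < ε u * (ρ u y - ρ u x) := fun u =>
    aux_pos (ρ u) M (h1 u) (h2 u) hM R hR
  have emul : ∀ u v, ε (u * v) = ε u * ε v := by
    intro u v
    have hy : 0 ≤ M * R + M * M := by positivity
    obtain ⟨y, hyd⟩ : ∃ y, y = R + M * R + M * M := ⟨_, rfl⟩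
    have a := pos (u * v) 0 y (by linarith)
    have b := pos v 0 y (by linarith)
    have c := h2 v y 0
    have d : R ≤ |ρ v y - ρ v 0| := by
      by_contra hc
      push Not at hc
      rw [sub_zero, abs_of_nonneg (by linarith)] at c
      nlinarith
    simp only [map_mul, Equiv.Perm.mul_apply] at a
    rcases e1 v with hv | hv
    · rw [hv] at b ⊢
      rw [abs_of_pos (by linarith)] at d
      have := pos u _ _ d
      rcases e1 u with hu | hu <;> rcases e1 (u * v) with huv | huv <;>
        rw [huv] at a <;> rw [hu] at this <;> rw [hu, huv] <;> linarith
    · rw [hv] at b ⊢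
      rw [abs_of_neg (by linarith)] at d
      have := pos u (ρ v y) (ρ v 0) (by linarith)
      rcases e1 u with hu | hu <;> rcases e1 (u * v) with huv | huv <;>
        rw [huv] at a <;> rw [hu] at this <;> rw [hu, huv] <;> linarith
  -- the support
  have supp : ∀ u x, (Function.support fun n => ss (ρ u x) n - ε u * ss x ((ρ u)⁻¹ n)) ⊆
      ((Finset.Icc (ρ u x - C') (ρ u x + C') : Finset ℤ) : Set ℤ) := by
    intro u x n hn
    obtain ⟨y, rfl⟩ := (ρ u).surjective n
    by_contra hc
    apply hn
    simp only [Finset.coe_Icc, Set.mem_Icc, not_and_or, not_le] at hc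
    have hD : C' < |ρ u y - ρ u x| := by grind
    have := h1 u y x
    have hd : R < |y - x| := by
      by_contra hh
      push Not at hh
      nlinarith
    have hi : (ρ u)⁻¹ (ρ u y) = y := (ρ u).symm_apply_apply y
    simp only [ss, hi]
    have hC0 : 0 < C' := by rw [hC', ← hR]; positivity
    rcases lt_abs.1 hd with hd | hd
    · have p := pos u x y hd.le
      rcases e1 u with hu | hu <;> rw [hu] at p ⊢ <;> split_ifs <;> first | omega | simp
    · have p := pos u y x (by linarith)
      rcases e1 u with hu | hu <;> rw [hu] at p ⊢ <;> split_ifs <;> first | omega | simp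
  have fin0 : ∀ u x, (Function.support fun n => ss (ρ u x) n - ε u * ss x ((ρ u)⁻¹ n)).Finite :=
    fun u x => (Finset.finite_toSet _).subset (supp u x)
  have fin : ∀ u, (Function.support fun n => ss 0 n - ε u * ss 0 ((ρ u)⁻¹ n)).Finite := by
    intro u
    apply ((fin0 u 0).union (ss_fin 0 (ρ u 0))).subset
    intro n hn
    simp only [Set.mem_union, Function.mem_support] at hn ⊢
    by_contra hc
    push Not at hc
    apply hn
    linarith [hc.1, hc.2]
  set T : U → ℤ := fun u => ∑ᶠ n, (ss 0 n - ε u * ss 0 ((ρ u)⁻¹ n)) with hT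
  have finc : ∀ (u : U) (g : ℤ → ℤ), (Function.support g).Finite →
      (Function.support fun n => ε u * g ((ρ u)⁻¹ n)).Finite := by
    intro u g hg
    apply (hg.image (ρ u)).subset
    intro n hn
    refine ⟨(ρ u)⁻¹ n, ?_, by simp⟩
    intro h0
    apply hn
    show ε u * g ((ρ u)⁻¹ n) = 0
    rw [h0, mul_zero]
  have sumc : ∀ (u : U) (g : ℤ → ℤ), ∑ᶠ n, ε u * g ((ρ u)⁻¹ n) = ε u * ∑ᶠ n, g n := by
    intro u g
    rw [← finsum_comp_equiv (ρ u)⁻¹ (f := g)]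
    rcases e1 u with hu | hu
    · simp [hu]
    · simp [hu, finsum_neg_distrib]
  refine ⟨ε, T, e1, emul, ?_, ?_⟩
  · intro u v
    simp only [hT]
    rw [← sumc u, ← finsum_add_distrib (fin u) (finc u _ (fin v))]
    apply finsum_congr
    intro n
    rw [emul]
    simp only [map_mul, mul_inv_rev, Equiv.Perm.mul_apply]
    ring
  · intro u x
    have key : ε u * (2 * x) + T u - 2 * ρ u x =
        ∑ᶠ n, (ss (ρ u x) n - ε u * ss x ((ρ u)⁻¹ n)) := by
      have a := ss_sum 0 x
      have b := ss_sum (ρ u x) 0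
      have c := sumc u (fun n => ss 0 n - ss x n)
      rw [a] at c
      have : ε u * (2 * x) + T u - 2 * ρ u x = (ε u * (2 * (x - 0)) + T u) + 2 * (0 - ρ u x) := by
        ring
      rw [this, ← b, ← c]
      simp only [hT]
      have f1 := finc u _ (ss_fin 0 x)
      rw [← finsum_add_distrib f1 (fin u), ← finsum_add_distrib _ (ss_fin _ _)]
      · apply finsum_congr
        intro n
        ring
      · exact (f1.union (fin u)).subset (Function.support_add _ _)
    rw [key, finsum_eq_sum_of_support_subset _ (supp u x)]
    refine (Finset.abs_sum_le_sum_abs _ _).trans ?_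
    refine (Finset.sum_le_card_nsmul _ _ 2 ?_).trans ?_
    · intro n _
      simp only [ss]
      rcases e1 u with hu | hu <;> rw [hu] <;> split_ifs <;> simp
    · have hC0 : 0 < C' := by rw [hC', ← hR]; positivity
      simp only [Int.card_Icc, nsmul_eq_mul]
      rw [Int.toNat_of_nonneg (by linarith)]
      linarith

lemma equi {U : Type} [Group U] (ρ : U →* Equiv.Perm ℤ) (ε T : U → ℤ) (C : ℤ)
    (e1 : ∀ u, ε u = 1 ∨ ε u = -1) (emul : ∀ u v, ε (u * v) = ε u * ε v)
    (Tmul : ∀ u v, T (u * v) = T u + ε u * T v)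
    (hC : ∀ u x, |ε u * (2 * x) + T u - 2 * ρ u x| ≤ C) :
    ∃ f : ℤ → ℤ, (∀ u x, f (ρ u x) = ε u * f x + 2 * T u) ∧ ∀ x, |f x - 4 * x| ≤ 2 * C := by
  have esq : ∀ u, ε u * ε u = 1 := by
    intro u; rcases e1 u with h | h <;> rw [h] <;> rfl
  set g : ℤ → U → ℤ := fun x u => ε u * (2 * ρ u x - T u) with hg
  have hb : ∀ x u, |g x u - 2 * x| ≤ C := by
    intro x u
    have := hC u x
    simp only [hg]
    rcases e1 u with h | h <;> rw [h] at this ⊢ <;> rw [abs_le] at this ⊢ <;>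
      constructor <;> linarith [this.1, this.2]
  have hne : ∀ x, (Set.range (g x)).Nonempty := fun x => ⟨g x 1, 1, rfl⟩
  have ha : ∀ x, BddAbove (Set.range (g x)) := by
    intro x
    refine ⟨2 * x + C, ?_⟩
    rintro _ ⟨u, rfl⟩
    linarith [(abs_le.1 (hb x u)).2]
  have hl : ∀ x, BddBelow (Set.range (g x)) := by
    intro x
    refine ⟨2 * x - C, ?_⟩
    rintro _ ⟨u, rfl⟩
    linarith [(abs_le.1 (hb x u)).1]
  have hgt : ∀ v x u, g (ρ v x) u = ε v * g x (u * v) + T v := by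
    intro v x u
    simp only [hg, emul, Tmul, map_mul, Equiv.Perm.mul_apply]
    linear_combination (-2 * ε u * ρ u (ρ v x) + ε u * T u + ε u * ε u * T v) * (esq v) + T v * esq u
  have lubs : ∀ x, ∃ a b, IsGreatest (Set.range (g x)) a ∧ IsLeast (Set.range (g x)) b := fun x =>
    ⟨_, _, ⟨Int.csSup_mem (hne x) (ha x), fun _ h => le_csSup (ha x) h⟩,
      ⟨Int.csInf_mem (hne x) (hl x), fun _ h => csInf_le (hl x) h⟩⟩
  choose a b haa hbb using lubs
  refine ⟨fun x => a x + b x, ?_, ?_⟩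
  · intro v x
    have mem : ∀ x u, g x u ≤ a x ∧ b x ≤ g x u := fun x u =>
      ⟨(haa x).2 ⟨u, rfl⟩, (hbb x).2 ⟨u, rfl⟩⟩
    obtain ⟨u1, h1⟩ := (haa x).1
    obtain ⟨u2, h2⟩ := (hbb x).1
    obtain ⟨u3, h3⟩ := (haa (ρ v x)).1
    obtain ⟨u4, h4⟩ := (hbb (ρ v x)).1
    have k1 := mem (ρ v x) (u1 * v⁻¹)
    have k2 := mem (ρ v x) (u2 * v⁻¹)
    have k3 := mem x (u3 * v)
    have k4 := mem x (u4 * v)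
    rw [hgt] at k1 k2 h3 h4
    simp only [inv_mul_cancel_right] at k1 k2
    show a (ρ v x) + b (ρ v x) = ε v * (a x + b x) + 2 * T v
    rcases e1 v with h | h <;> rw [h] at k1 k2 h3 h4 ⊢ <;> linarith [k1.1, k1.2, k2.1, k2.2, k3.1, k3.2, k4.1, k4.2]
  · intro x
    obtain ⟨u1, h1⟩ := (haa x).1
    obtain ⟨u2, h2⟩ := (hbb x).1
    have i1 := abs_le.1 (hb x u1)
    have i2 := abs_le.1 (hb x u2)
    show |a x + b x - 4 * x| ≤ 2 * C
    rw [abs_le]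
    constructor <;> linarith [i1.1, i1.2, i2.1, i2.2]

lemma relabel (f : ℤ → ℤ) (C : ℤ) (hf : ∀ x, |f x - 4 * x| ≤ 2 * C) :
    Nonempty (Set.range f ≃o ℤ) := by
  have hf' := fun x => abs_le.1 (hf x)
  classical
  haveI : Nonempty (Set.range f) := ⟨⟨f 0, 0, rfl⟩⟩
  haveI : NoMaxOrder (Set.range f) := by
    constructor
    rintro ⟨_, x, rfl⟩
    refine ⟨⟨f (x + C + 1), _, rfl⟩, ?_⟩
    show f x < f (x + C + 1)
    linarith [(hf' x).2, (hf' (x + C + 1)).1]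
  haveI : NoMinOrder (Set.range f) := by
    constructor
    rintro ⟨_, x, rfl⟩
    refine ⟨⟨f (x - C - 1), _, rfl⟩, ?_⟩
    show f (x - C - 1) < f x
    linarith [(hf' x).1, (hf' (x - C - 1)).2]
  haveI : LocallyFiniteOrder (Set.range f) :=
    inferInstanceAs (LocallyFiniteOrder {x // x ∈ Set.range f})
  letI : SuccOrder (Set.range f) := LinearLocallyFiniteOrder.succOrder _
  letI : PredOrder (Set.range f) := LinearLocallyFiniteOrder.predOrder _
  exact ⟨orderIsoIntOfLinearSuccPredArch⟩

lemma finish {U : Type} [Group U] (ρ : U →* Equiv.Perm ℤ) (ε T : U → ℤ) (C : ℤ)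
    (e1 : ∀ u, ε u = 1 ∨ ε u = -1)
    (f : ℤ → ℤ) (hf : ∀ u x, f (ρ u x) = ε u * f x + 2 * T u)
    (hc : ∀ x, |f x - 4 * x| ≤ 2 * C) :
    ∃ (σ : U →* Equiv.Perm ℤ) (F : ℤ → ℤ),
      (∀ u m n, |σ u m - σ u n| = |m - n|) ∧ Function.Surjective F ∧
      (∀ u n, F (ρ u n) = σ u (F n)) ∧
      (∀ x y, |F x - F y| ≤ |f x - f y|) ∧
      (∀ x y, |f x - f y| ≤ (8 * C + 4) * |F x - F y|) := by
  obtain ⟨e⟩ := relabel f C hc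
  set F : ℤ → ℤ := fun x => e ⟨f x, x, rfl⟩ with hF
  have Fs : Function.Surjective F := by
    intro n
    obtain ⟨⟨_, x, rfl⟩, h⟩ := e.surjective n
    exact ⟨x, h⟩
  set g : ℤ → ℤ := fun n => (e.symm n : ℤ) with hg
  have gF : ∀ x, g (F x) = f x := by intro x; simp [hg, hF]
  have gm : StrictMono g := fun a b h => e.symm.strictMono h
  have Fiff : ∀ x y, F x < F y ↔ f x < f y := by
    intro x y; rw [← gF x, ← gF y, gm.lt_iff_lt]
  have Feq : ∀ x y, F x = F y ↔ f x = f y := by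
    intro x y; rw [← gF x, ← gF y, gm.injective.eq_iff]
  -- the action
  have hinv : ∀ n, F (Function.surjInv Fs n) = n := Function.surjInv_eq Fs
  set r := Function.surjInv Fs with hr
  set s : U → ℤ → ℤ := fun u n => F (ρ u (r n)) with hs
  have sF : ∀ u x, s u (F x) = F (ρ u x) := by
    intro u x
    simp only [hs]
    rw [Feq, hf, hf, (Feq _ _).1 (hinv (F x))]
  have smul : ∀ u v n, s (u * v) n = s u (s v n) := by
    intro u v n
    obtain ⟨x, rfl⟩ := Fs n
    rw [sF (u * v), sF v, sF u]; simp
  have sone : ∀ n, s 1 n = n := by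
    intro n
    obtain ⟨x, rfl⟩ := Fs n
    rw [sF]; simp
  have expd : ∀ u m n, |m - n| ≤ |s u m - s u n| := by
    intro u m n
    rcases e1 u with h | h
    · apply strict_exp_abs (s u)
      intro a b hab
      obtain ⟨x, rfl⟩ := Fs a
      obtain ⟨y, rfl⟩ := Fs b
      rw [Fiff] at hab
      rw [sF, sF, Fiff, hf, hf, h]; linarith
    · have := strict_exp_abs (fun n => - s u n) (by
        intro a b hab
        obtain ⟨x, rfl⟩ := Fs a
        obtain ⟨y, rfl⟩ := Fs b
        rw [Fiff] at hab
        simp only [neg_lt_neg_iff]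
        rw [sF, sF, Fiff, hf, hf, h]; linarith) m n
      rw [← abs_neg (s u m - s u n)]
      convert this using 2
      ring
  refine ⟨{ toFun := fun u => ⟨s u, s u⁻¹, fun n => by rw [← smul]; simp [sone],
      fun n => by rw [← smul]; simp [sone]⟩, map_one' := ?_, map_mul' := ?_ }, F, ?_, Fs, ?_, ?_, ?_⟩
  · ext n; exact sone n
  · intro u v; ext n; exact smul u v n
  · intro u m n
    show |s u m - s u n| = |m - n|
    apply le_antisymm _ (expd u m n)
    have := expd u⁻¹ (s u m) (s u n)
    rw [← smul, ← smul] at this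
    simpa [sone] using this
  · intro u n
    exact (sF u n).symm
  · intro x y
    rw [← gF x, ← gF y]
    exact strict_exp_abs g gm _ _
  · have hc' := fun x => abs_le.1 (hc x)
    have gap : ∀ n, g (n + 1) ≤ g n + (8 * C + 4) := by
      intro n
      obtain ⟨x, rfl⟩ := Fs n
      have : F x < F (x + C + 1) := by
        rw [Fiff]; linarith [(hc' x).2, (hc' (x + C + 1)).1]
      have := gm.monotone (Int.add_one_le_iff.2 this)
      rw [gF] at this ⊢
      linarith [(hc' x).1, (hc' (x + C + 1)).2]
    have gle : ∀ m n, m ≤ n → g n - g m ≤ (8 * C + 4) * (n - m) := by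
      intro m n hmn
      induction n, hmn using Int.leInduction with
      | base => simp
      | succ n _ ih => linarith [gap n]
    intro x y
    rw [← gF x, ← gF y]
    rcases le_total (F x) (F y) with h | h
    · rw [abs_sub_comm, abs_sub_comm (F x), abs_of_nonneg (sub_nonneg.2 h),
        abs_of_nonneg (sub_nonneg.2 (gm.monotone h))]
      exact gle _ _ h
    · rw [abs_of_nonneg (sub_nonneg.2 h), abs_of_nonneg (sub_nonneg.2 (gm.monotone h))]
      exact gle _ _ h

/-- If a group `U` acts on `ℤ` by bijections each of which is an
`(L,A)`-quasi-isometry, then there is an isometric action of `U` on `ℤ` and a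
surjective `U`-equivariant `(L',A')`-quasi-isometry `f : ℤ → ℤ` from the first
action to the second, where `L'` and `A'` depend only on `L` and `A`. -/
theorem stmt0 :
    ∀ L A : ℝ, ∃ L' A' : ℝ,
      ∀ (U : Type) [Group U] (ρ : U →* Equiv.Perm ℤ),
        (∀ u : U, IsQIZ L A (ρ u)) →
        ∃ (σ : U →* Equiv.Perm ℤ) (f : ℤ → ℤ),
          (∀ (u : U) (m n : ℤ), |((σ u m : ℤ) : ℝ) - ((σ u n : ℤ) : ℝ)| = |(m : ℝ) - n|) ∧
          Function.Surjective f ∧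
          (∀ (u : U) (n : ℤ), f (ρ u n) = σ u (f n)) ∧
          IsQIZ L' A' f := by
  intro L A
  obtain ⟨M, hM⟩ : ∃ M : ℤ, M = max 1 ⌈max L A⌉ := ⟨_, rfl⟩
  have hM1 : 1 ≤ M := hM ▸ le_max_left _ _
  have hMc : max L A ≤ (M : ℝ) := (Int.le_ceil _).trans (by rw [hM]; exact_mod_cast le_max_right _ _)
  have hML : L ≤ M := (le_max_left _ _).trans hMc
  have hMA : A ≤ M := (le_max_right _ _).trans hMc
  obtain ⟨C, hC⟩ : ∃ C : ℤ, C = 2 * (2 * (M * (3 * M * M + 1) + M) + 1) := ⟨_, rfl⟩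
  have hCp : 0 ≤ C := by rw [hC]; positivity
  refine ⟨8 * C + 4, 4 * C, ?_⟩
  intro U _ ρ hρ
  have hid := (hρ 1).1
  simp only [map_one, Equiv.Perm.one_apply] at hid
  have hA0 : 0 ≤ A := by simpa using (hid 0 0).2
  have hL : 0 < L := by
    by_contra hL
    push Not at hL
    obtain ⟨N, hN⟩ := exists_nat_gt A
    have := (hid N 0).2
    simp at this
    nlinarith [(Nat.cast_nonneg N : (0 : ℝ) ≤ N)]
  have h1 : ∀ u m n, |ρ u m - ρ u n| ≤ M * |m - n| + M := by
    intro u m n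
    have := ((hρ u).1 m n).2
    have h0 := abs_nonneg ((m : ℝ) - n)
    have : |(ρ u m : ℝ) - ρ u n| ≤ M * |(m : ℝ) - n| + M := by nlinarith
    exact_mod_cast this
  have h2 : ∀ u m n, |m - n| ≤ M * |ρ u m - ρ u n| + M * M := by
    intro u m n
    have := ((hρ u).1 m n).1
    have h0 := abs_nonneg ((ρ u m : ℝ) - ρ u n)
    have h3 : |(m : ℝ) - n| ≤ L * (|(ρ u m : ℝ) - ρ u n| + A) := by
      rw [← inv_mul_le_iff₀ hL]; linarith
    have : |(m : ℝ) - n| ≤ M * |(ρ u m : ℝ) - ρ u n| + M * M := by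
      have : L * (|(ρ u m : ℝ) - ρ u n| + A) ≤ M * (|(ρ u m : ℝ) - ρ u n| + M) := by
        gcongr
      linarith
    exact_mod_cast this
  obtain ⟨ε, T, e1, emul, Tmul, hT⟩ := flux ρ M hM1 h1 h2 _ rfl
  rw [← hC] at hT
  obtain ⟨f, hf, hfc⟩ := equi ρ ε T C e1 emul Tmul hT
  obtain ⟨σ, F, i1, i2, i3, i4, i5⟩ := finish ρ ε T C e1 f hf hfc
  refine ⟨σ, F, ?_, i2, i3, ?_, ?_⟩
  · intro u m n
    exact_mod_cast i1 u m n
  · intro m n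
    have hlow : |m - n| - 4 * C ≤ |f m - f n| := by
      have a := hfc m
      have b := hfc n
      grind
    have hup : |f m - f n| ≤ 4 * |m - n| + 4 * C := by
      have a := hfc m
      have b := hfc n
      grind
    have a : |m - n| ≤ (8 * C + 4) * (|F m - F n| + 4 * C) := by
      have := i5 m n
      nlinarith
    have b : |F m - F n| ≤ (8 * C + 4) * |m - n| + 4 * C := by
      have := i4 m n
      nlinarith [abs_nonneg (m - n)]
    constructor
    · rw [sub_le_iff_le_add, inv_mul_le_iff₀ (by positivity)]
      exact_mod_cast a
    · exact_mod_cast b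
  · intro n
    obtain ⟨m, rfl⟩ := i2 n
    refine ⟨m, ?_⟩
    simp
    exact_mod_cast hCp
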